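/- Let τ > 0, let U⁰, U¹, V⁰, V¹, B be (N_x+1)×(N_y+1) real matrices and R⁰, R¹ real numbers satisfying one step of the linearly implicit SAV scheme based on the SBP discretization: (U¹ − U⁰)/τ = (V¹ + V⁰)/2, (V¹ − V⁰)/τ = Δ̄_h((U¹ + U⁰)/2) − B·(R¹ + R⁰)/2, and R¹ − R⁰ = ½(B, U¹ − U⁰)_Λ. Then the fully discrete weighted modified energy is exactly conserved: ½‖V¹‖_Λ² + ½‖∇_h⁺U¹‖_Λ² + (R¹)² = ½‖V⁰‖_Λ² + ½‖∇_h⁺U⁰‖_Λ² + (R⁰)². -/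

import Mathlib

open Matrix

noncomputable section

/-- Forward difference matrix `D⁺` on a grid with `M` points:
`(D⁺)_{j,j} = -1/h`, `(D⁺)_{j,j+1} = 1/h` for the first `M-1` rows, last row zero. -/
def Dplus (M : ℕ) (h : ℝ) : Matrix (Fin M) (Fin M) ℝ :=
  Matrix.of fun j k =>
    if (j : ℕ) + 1 < M then
      if k = j then -1 / h else if (k : ℕ) = (j : ℕ) + 1 then 1 / h else 0
    else 0

/-- Backward difference matrix `D⁻`: `(D⁻)_{j,j} = 1/h`, `(D⁻)_{j,j-1} = -1/h`
for all rows but the first, first row zero. -/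
def Dminus (M : ℕ) (h : ℝ) : Matrix (Fin M) (Fin M) ℝ :=
  Matrix.of fun j k =>
    if 1 ≤ (j : ℕ) then
      if k = j then 1 / h else if (k : ℕ) + 1 = (j : ℕ) then -1 / h else 0
    else 0

/-- Symmetric second-order difference matrix `D²` with Neumann corners:
diagonal `(-1, -2, …, -2, -1)/h²`, off-diagonals `1/h²`. -/
def D2 (M : ℕ) (h : ℝ) : Matrix (Fin M) (Fin M) ℝ :=
  Matrix.of fun j k =>
    if k = j then (if (j : ℕ) = 0 ∨ (j : ℕ) = M - 1 then -1 / h ^ 2 else -2 / h ^ 2)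
    else if (k : ℕ) = (j : ℕ) + 1 ∨ (j : ℕ) = (k : ℕ) + 1 then 1 / h ^ 2
    else 0

/-- SBP weight matrix `Λ = diag(1/2, 1, …, 1, 1/2)`. -/
def Lam (M : ℕ) : Matrix (Fin M) (Fin M) ℝ :=
  Matrix.of fun j k =>
    if k = j then (if (j : ℕ) = 0 ∨ (j : ℕ) = M - 1 then 1 / 2 else 1) else 0

/-- Regular-grid second-order central difference matrix with ghost-point Neumann closure. -/
def Dbar2 (M : ℕ) (h : ℝ) : Matrix (Fin M) (Fin M) ℝ :=
  Matrix.of fun j k =>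
    if (j : ℕ) = 0 then
      if (k : ℕ) = 0 then -2 / h ^ 2 else if (k : ℕ) = 1 then 2 / h ^ 2 else 0
    else if (j : ℕ) = M - 1 then
      if (k : ℕ) = M - 1 then -2 / h ^ 2 else if (k : ℕ) = M - 2 then 2 / h ^ 2 else 0
    else
      if k = j then -2 / h ^ 2
      else if (k : ℕ) = (j : ℕ) + 1 ∨ (j : ℕ) = (k : ℕ) + 1 then 1 / h ^ 2 else 0

/-- Discrete `L²` inner product `(u,v)_h = h_x h_y ∑_{j,k} u_{jk} v_{jk}`. -/
def iph {m n : ℕ} (hx hy : ℝ) (u v : Matrix (Fin m) (Fin n) ℝ) : ℝ :=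
  hx * hy * ∑ j, ∑ k, u j k * v j k

/-- Entrywise `Φ · sin U`. -/
def hadSin {m n : ℕ} (Φ U : Matrix (Fin m) (Fin n) ℝ) : Matrix (Fin m) (Fin n) ℝ :=
  Matrix.of fun j k => Φ j k * Real.sin (U j k)

/-- Entrywise `Φ · (𝟙 - cos U)`. -/
def hadOneSubCos {m n : ℕ} (Φ U : Matrix (Fin m) (Fin n) ℝ) : Matrix (Fin m) (Fin n) ℝ :=
  Matrix.of fun j k => Φ j k * (1 - Real.cos (U j k))

/-- The all-ones matrix `𝟙`. -/
def oneM (m n : ℕ) : Matrix (Fin m) (Fin n) ℝ := Matrix.of fun _ _ => 1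

theorem Dplus_transpose_mul_self {N : ℕ} (hN : 0 < N) (h : ℝ) :
    (Dplus (N + 1) h)ᵀ * Dplus (N + 1) h = -D2 (N + 1) h := by
  ext j k
  rw [Matrix.mul_apply]
  simp only [Matrix.transpose_apply, Matrix.neg_apply]
  cases j using Fin.cases with
  | zero =>
    rw [Finset.sum_eq_single (0 : Fin (N + 1))]
    · simp only [Dplus, D2, Matrix.of_apply, Fin.ext_iff, Fin.val_zero]
      split_ifs <;> first | (exfalso; omega) | ring1 | grind
    · intro i _ hi
      simp only [Dplus, Matrix.of_apply, Fin.ext_iff, Fin.val_zero, ne_eq] at hi ⊢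
      split_ifs <;> first | (exfalso; omega) | ring1
    · simp
  | succ p =>
    have hne : p.castSucc ≠ p.succ := by simp [Fin.ext_iff]
    rw [Finset.sum_eq_add p.castSucc p.succ hne]
    · have hp := p.isLt
      simp only [Dplus, D2, Matrix.of_apply, Fin.ext_iff, Fin.val_succ, Fin.val_castSucc]
      split_ifs <;> first | (exfalso; omega) | ring1 | grind
    · rintro i _ ⟨hi, hi'⟩
      simp only [Dplus, Matrix.of_apply, Fin.ext_iff, Fin.val_succ, Fin.val_castSucc,
        ne_eq] at hi hi' ⊢
      split_ifs <;> first | (exfalso; omega) | ring1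
    · simp
    · simp

theorem D2_transpose (M : ℕ) (h : ℝ) : (D2 M h)ᵀ = D2 M h := by
  ext j k
  simp only [D2, Matrix.transpose_apply, Matrix.of_apply, Fin.ext_iff]
  split_ifs <;> first | omega | rfl

theorem Lam_eq_diagonal (M : ℕ) :
    Lam M = Matrix.diagonal fun j : Fin M =>
      if (j : ℕ) = 0 ∨ (j : ℕ) = M - 1 then (1 / 2 : ℝ) else 1 := by
  ext j k
  simp only [Lam, Matrix.of_apply, Matrix.diagonal_apply, eq_comm]

theorem Lam_transpose (M : ℕ) : (Lam M)ᵀ = Lam M := by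
  rw [Lam_eq_diagonal, Matrix.diagonal_transpose]

theorem isUnit_det_Lam (M : ℕ) : IsUnit (Lam M).det := by
  rw [Lam_eq_diagonal, Matrix.det_diagonal, isUnit_iff_ne_zero, Finset.prod_ne_zero_iff]
  intro j _
  split_ifs <;> norm_num

section iph

variable {m n : ℕ} (hx hy : ℝ)

theorem iph_eq_trace (u v : Matrix (Fin m) (Fin n) ℝ) :
    iph hx hy u v = hx * hy * (u * vᵀ).trace := by
  simp [iph, Matrix.trace, Matrix.mul_apply]

theorem iph_comm (u v : Matrix (Fin m) (Fin n) ℝ) : iph hx hy u v = iph hx hy v u := by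
  simp only [iph, mul_comm (u _ _)]

theorem iph_add_left (u u' v : Matrix (Fin m) (Fin n) ℝ) :
    iph hx hy (u + u') v = iph hx hy u v + iph hx hy u' v := by
  simp only [iph_eq_trace, Matrix.add_mul, Matrix.trace_add, mul_add]

theorem iph_sub_left (u u' v : Matrix (Fin m) (Fin n) ℝ) :
    iph hx hy (u - u') v = iph hx hy u v - iph hx hy u' v := by
  simp only [iph_eq_trace, Matrix.sub_mul, Matrix.trace_sub, mul_sub]

theorem iph_neg_left (u v : Matrix (Fin m) (Fin n) ℝ) :
    iph hx hy (-u) v = -iph hx hy u v := by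
  simp only [iph_eq_trace, Matrix.neg_mul, Matrix.trace_neg, mul_neg]

theorem iph_smul_left (c : ℝ) (u v : Matrix (Fin m) (Fin n) ℝ) :
    iph hx hy (c • u) v = c * iph hx hy u v := by
  simp only [iph_eq_trace, Matrix.smul_mul, Matrix.trace_smul, smul_eq_mul]
  ring

theorem iph_add_right (u v v' : Matrix (Fin m) (Fin n) ℝ) :
    iph hx hy u (v + v') = iph hx hy u v + iph hx hy u v' := by
  simp only [iph_comm hx hy u, iph_add_left]

theorem iph_sub_right (u v v' : Matrix (Fin m) (Fin n) ℝ) :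
    iph hx hy u (v - v') = iph hx hy u v - iph hx hy u v' := by
  simp only [iph_comm hx hy u, iph_sub_left]

theorem iph_smul_right (c : ℝ) (u v : Matrix (Fin m) (Fin n) ℝ) :
    iph hx hy u (c • v) = c * iph hx hy u v := by
  simp only [iph_comm hx hy u, iph_smul_left]

theorem iph_mul_right (A : Matrix (Fin m) (Fin m) ℝ) (u v : Matrix (Fin m) (Fin n) ℝ) :
    iph hx hy u (A * v) = iph hx hy (Aᵀ * u) v := by
  simp only [iph_eq_trace, Matrix.transpose_mul]
  rw [← Matrix.mul_assoc, Matrix.trace_mul_comm, Matrix.mul_assoc]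

theorem iph_mul_right' (A : Matrix (Fin n) (Fin n) ℝ) (u v : Matrix (Fin m) (Fin n) ℝ) :
    iph hx hy u (v * A) = iph hx hy (u * Aᵀ) v := by
  simp only [iph_eq_trace, Matrix.transpose_mul, Matrix.mul_assoc]

theorem iph_weighted_comm {P : Matrix (Fin m) (Fin m) ℝ} {Q : Matrix (Fin n) (Fin n) ℝ}
    (hP : Pᵀ = P) (hQ : Qᵀ = Q) (u v : Matrix (Fin m) (Fin n) ℝ) :
    iph hx hy (P * u * Q) v = iph hx hy (P * v * Q) u := by
  rw [iph_comm, iph_mul_right', iph_mul_right, hP, hQ, Matrix.mul_assoc]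

theorem iph_weighted_sub_add {P : Matrix (Fin m) (Fin m) ℝ} {Q : Matrix (Fin n) (Fin n) ℝ}
    (hP : Pᵀ = P) (hQ : Qᵀ = Q) (u v : Matrix (Fin m) (Fin n) ℝ) :
    iph hx hy (P * (u - v) * Q) (u + v) =
      iph hx hy (P * u * Q) u - iph hx hy (P * v * Q) v := by
  simp only [Matrix.mul_sub, Matrix.sub_mul, iph_sub_left, iph_add_right]
  rw [iph_weighted_comm hx hy hP hQ v u]
  ring

end iph

/-- Summation by parts in the first variable. -/
theorem iph_Dplus_mul {N n : ℕ} (hN : 0 < N) (hx hy h : ℝ) (Q : Matrix (Fin n) (Fin n) ℝ)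
    (u v : Matrix (Fin (N + 1)) (Fin n) ℝ) :
    iph hx hy (Dplus (N + 1) h * u * Q) (Dplus (N + 1) h * v) =
      -iph hx hy (D2 (N + 1) h * u * Q) v := by
  rw [iph_mul_right, ← Matrix.mul_assoc, ← Matrix.mul_assoc, Dplus_transpose_mul_self hN,
    Matrix.neg_mul, Matrix.neg_mul, iph_neg_left]

/-- Summation by parts in the second variable. -/
theorem iph_mul_Dplus_transpose {m N : ℕ} (hN : 0 < N) (hx hy h : ℝ)
    (P : Matrix (Fin m) (Fin m) ℝ) (u v : Matrix (Fin m) (Fin (N + 1)) ℝ) :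
    iph hx hy (P * (u * (Dplus (N + 1) h)ᵀ)) (v * (Dplus (N + 1) h)ᵀ) =
      -iph hx hy (P * u * D2 (N + 1) h) v := by
  rw [iph_mul_right', Matrix.transpose_transpose, ← Matrix.mul_assoc, Matrix.mul_assoc _ _ᵀ,
    Dplus_transpose_mul_self hN, Matrix.mul_neg, iph_neg_left]

/-- One step of the linearly implicit SAV scheme based on the SBP discretization exactly
conserves the fully discrete weighted modified energy. -/
theorem stmt17 (Nx Ny : ℕ) (hNx : 0 < Nx) (hNy : 0 < Ny)
    (hx hy : ℝ) (hhx : 0 < hx) (hhy : 0 < hy) (τ : ℝ) (hτ : 0 < τ)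
    (U0 U1 V0 V1 B : Matrix (Fin (Nx + 1)) (Fin (Ny + 1)) ℝ) (R0 R1 : ℝ)
    (heq1 : τ⁻¹ • (U1 - U0) = (2 : ℝ)⁻¹ • (V1 + V0))
    (heq2 : τ⁻¹ • (V1 - V0) =
      (Lam (Nx + 1))⁻¹ * D2 (Nx + 1) hx * ((2 : ℝ)⁻¹ • (U1 + U0)) +
        ((2 : ℝ)⁻¹ • (U1 + U0)) * D2 (Ny + 1) hy * (Lam (Ny + 1))⁻¹ -
        ((R1 + R0) / 2) • B)
    (heq3 : R1 - R0 = (1 / 2) * iph hx hy (Lam (Nx + 1) * B * Lam (Ny + 1)) (U1 - U0)) :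
    (1 / 2) * iph hx hy (Lam (Nx + 1) * V1 * Lam (Ny + 1)) V1 +
      (1 / 2) * (iph hx hy (Dplus (Nx + 1) hx * U1 * Lam (Ny + 1)) (Dplus (Nx + 1) hx * U1) +
        iph hx hy (Lam (Nx + 1) * (U1 * (Dplus (Ny + 1) hy)ᵀ)) (U1 * (Dplus (Ny + 1) hy)ᵀ)) +
      R1 ^ 2 =
    (1 / 2) * iph hx hy (Lam (Nx + 1) * V0 * Lam (Ny + 1)) V0 +
      (1 / 2) * (iph hx hy (Dplus (Nx + 1) hx * U0 * Lam (Ny + 1)) (Dplus (Nx + 1) hx * U0) +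
        iph hx hy (Lam (Nx + 1) * (U0 * (Dplus (Ny + 1) hy)ᵀ)) (U0 * (Dplus (Ny + 1) hy)ᵀ)) +
      R0 ^ 2 := by
  have hLx := Lam_transpose (Nx + 1)
  have hLy := Lam_transpose (Ny + 1)
  have hV := iph_weighted_sub_add hx hy hLx hLy V1 V0
  have hX := iph_weighted_sub_add hx hy (D2_transpose (Nx + 1) hx) hLy U1 U0
  have hY := iph_weighted_sub_add hx hy hLx (D2_transpose (Ny + 1) hy) U1 U0
  rw [iph_weighted_comm hx hy (D2_transpose (Nx + 1) hx) hLy] at hX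
  rw [iph_weighted_comm hx hy hLx (D2_transpose (Ny + 1) hy)] at hY
  have hVsum : V1 + V0 = (2 * τ⁻¹) • (U1 - U0) := by
    rw [mul_smul, heq1, smul_smul]
    norm_num
  have hpair : τ⁻¹ • (Lam (Nx + 1) * (V1 - V0) * Lam (Ny + 1)) =
      (2 : ℝ)⁻¹ • (D2 (Nx + 1) hx * (U1 + U0) * Lam (Ny + 1)) +
        (2 : ℝ)⁻¹ • (Lam (Nx + 1) * (U1 + U0) * D2 (Ny + 1) hy) -
        ((R1 + R0) / 2) • (Lam (Nx + 1) * B * Lam (Ny + 1)) := by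
    rw [← Matrix.smul_mul, ← Matrix.mul_smul, heq2]
    simp only [Matrix.mul_add, Matrix.mul_sub, Matrix.add_mul, Matrix.sub_mul, Matrix.mul_smul,
      Matrix.smul_mul, smul_add, Matrix.mul_assoc,
      Matrix.mul_nonsing_inv_cancel_left _ _ (isUnit_det_Lam (Nx + 1)),
      Matrix.nonsing_inv_mul _ (isUnit_det_Lam (Ny + 1)), Matrix.mul_one]
  have hkey := congrArg (fun W => iph hx hy W (U1 - U0)) hpair
  simp only [iph_sub_left, iph_add_left, iph_smul_left] at hkey
  rw [hVsum, iph_smul_right] at hV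
  rw [iph_Dplus_mul hNx, iph_Dplus_mul hNx, iph_mul_Dplus_transpose hNy,
    iph_mul_Dplus_transpose hNy]
  linear_combination (-1 / 2) * hV + hkey + (1 / 2) * hX + (1 / 2) * hY + (R1 + R0) * heq3


end
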